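/- For integers r, N with 2√N ≤ r ≤ N, there exists a polynomial p of degree at most r with p(0) = 0 and max_{1 ≤ i ≤ N} |p(i) − 1| ≤ 2 exp(−c r²/(N log N)) for an absolute constant c > 0. -/

import Mathlib

lemma kls_prod_bound (k N i : ℕ) (h1 : 1 ≤ i) (hi : i ≤ N) (hk : k < i) :
    |∏ j ∈ Finset.range k, (1 - (i:ℝ) / ((j:ℝ) + 1))| ≤ (N:ℝ) ^ k := by
  rw [Finset.abs_prod]
  calc _ ≤ ∏ j ∈ Finset.range k, (N:ℝ) := by
        apply Finset.prod_le_prod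
        · intros; positivity
        · intro j hj
          have hj' : j < k := Finset.mem_range.mp hj
          have h2 : (j:ℝ) + 1 ≤ i := by exact_mod_cast (by omega : j + 1 ≤ i)
          have h3 : (1:ℝ) ≤ (i:ℝ) / ((j:ℝ) + 1) := by
            rw [le_div_iff₀ (by positivity)]; linarith
          have h4 : (i:ℝ) / ((j:ℝ) + 1) ≤ i := div_le_self (by positivity) (by
            have : (0:ℝ) ≤ j := by positivity
            linarith)
          have h5 : (i:ℝ) ≤ N := by exact_mod_cast hi
          rw [abs_le]; constructor <;> linarith
    _ = _ := by simp

lemma kls_cheb (m : ℕ) (d : ℝ) (hd : 0 ≤ d) (hd2 : d ≤ 2) :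
    Real.exp (m * Real.sqrt d) / 2 ≤ (Polynomial.Chebyshev.T ℝ m).eval (1 + d) := by
  set s := Real.sqrt d with hs
  have hs0 : 0 ≤ s := Real.sqrt_nonneg _
  have hsq : s ^ 2 = d := Real.sq_sqrt hd
  have hc : Real.cosh s ≤ 1 + d := by
    refine (Real.cosh_le_exp_half_sq s).trans ?_
    rw [hsq]
    have := Real.abs_exp_sub_one_le (x := d / 2) (by rw [abs_of_nonneg] <;> linarith)
    rw [abs_of_nonneg (a := d / 2) (by linarith)] at this
    linarith [le_abs_self (Real.exp (d/2) - 1)]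
  set t := Real.arcosh (1 + d) with ht
  have ht0 : 0 ≤ t := Real.arcosh_nonneg (by linarith)
  have hct : Real.cosh t = 1 + d := Real.cosh_arcosh (by linarith)
  have hst : s ≤ t := by
    rw [← hct, Real.cosh_le_cosh, abs_of_nonneg hs0, abs_of_nonneg ht0] at hc
    exact hc
  rw [← hct, Polynomial.Chebyshev.T_real_cosh]
  have h1 : Real.exp (m * s) ≤ Real.exp (m * t) := by
    apply Real.exp_le_exp.mpr
    gcongr
  rw [Real.cosh_eq]
  push_cast
  have := Real.exp_pos (-(m * t))
  linarith

/-- Kahn–Linial–Samorodnitsky flat polynomials: for integers r, N with 2√N ≤ r ≤ N,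
there is a polynomial p of degree at most r with p(0) = 0 and
max_{1 ≤ i ≤ N} |p(i) − 1| ≤ 2 exp(−c r²/(N log N)) for an absolute constant c > 0. -/
theorem stmt17 :
    ∃ c : ℝ, 0 < c ∧ ∀ r N : ℕ, 2 * Real.sqrt N ≤ r → r ≤ N →
      ∃ p : Polynomial ℝ, p.natDegree ≤ r ∧ p.eval 0 = 0 ∧
        ∀ i : ℕ, 1 ≤ i → i ≤ N →
          |p.eval (i : ℝ) - 1| ≤ 2 * Real.exp (-c * r ^ 2 / (N * Real.log N)) := by
  refine ⟨1/16, by norm_num, ?_⟩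
  intro r N h1 h2
  rcases Nat.eq_zero_or_pos N with hN | hN
  · exact ⟨0, by simp, by simp, by intros; omega⟩
  have hNR : (0:ℝ) < N := by exact_mod_cast hN
  have hrN : (r:ℝ) ≤ N := by exact_mod_cast h2
  have hr0 : (0:ℝ) ≤ r := by positivity
  have hN4 : (4:ℝ) ≤ N := by
    have h3 := Real.sq_sqrt hNR.le
    have h4 := Real.sqrt_pos.mpr hNR
    nlinarith
  have hlog : 1 ≤ Real.log N := by
    rw [Real.le_log_iff_exp_le hNR]
    linarith [Real.exp_one_lt_d9]
  set L := Real.log N with hL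
  have hL0 : 0 < L := by linarith
  set A : ℝ := r ^ 2 / (16 * N * L ^ 2) with hA
  have hA0 : 0 ≤ A := by positivity
  set k := ⌊A⌋₊ with hk
  have hkA : (k:ℝ) ≤ A := Nat.floor_le hA0
  have hAk : A < k + 1 := Nat.lt_floor_add_one A
  have hAr : A ≤ r / 16 := by
    rw [hA, div_le_div_iff₀ (by positivity) (by norm_num)]
    have : (1:ℝ) ≤ L ^ 2 := by nlinarith
    have h5 : (N:ℝ) ≤ N * L ^ 2 := by nlinarith
    nlinarith
  have hkr : k ≤ r := by
    have : (k:ℝ) ≤ r := by linarith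
    exact_mod_cast this
  obtain ⟨m, hm⟩ : ∃ m, r = k + m := ⟨r - k, by omega⟩
  have hmR : (r:ℝ) = k + m := by exact_mod_cast hm
  have hm2 : (r:ℝ) / 2 ≤ m := by linarith
  set d : ℝ := 2 * (k + 1) / N with hd
  have hd0 : 0 ≤ d := by positivity
  have hd2 : d ≤ 2 := by
    rw [hd, div_le_iff₀ hNR]; linarith
  have hT := kls_cheb m d hd0 hd2
  set T0 := (Polynomial.Chebyshev.T ℝ m).eval (1 + d) with hT0
  have hT0pos : 0 < T0 := lt_of_lt_of_le (by positivity) hT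
  have hsd : (r:ℝ) / (4 * N * L) ≤ Real.sqrt d := by
    apply Real.le_sqrt_of_sq_le
    have : ((r:ℝ) / (4 * N * L)) ^ 2 = A / N := by
      rw [hA]; field_simp; norm_num
    rw [this, hd]
    gcongr
    linarith
  have hms : (r:ℝ) ^ 2 / (8 * N * L) ≤ m * Real.sqrt d := by
    calc (r:ℝ) ^ 2 / (8 * N * L) = (r/2) * (r / (4 * N * L)) := by field_simp; ring
      _ ≤ _ := by gcongr
  have hkL : k * L ≤ (r:ℝ)^2 / (16 * N * L) := by
    calc k * L ≤ A * L := by gcongr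
      _ = _ := by rw [hA]; field_simp
  let lin : Polynomial ℝ := Polynomial.C (1 + d) - Polynomial.C (2 / (N:ℝ)) * Polynomial.X
  let P : Polynomial ℝ := ∏ j ∈ Finset.range k,
    (1 - Polynomial.C (1 / ((j:ℝ) + 1)) * Polynomial.X)
  let q : Polynomial ℝ := Polynomial.C (1 / T0) * (P * (Polynomial.Chebyshev.T ℝ m).comp lin)
  have hP : ∀ x : ℝ, P.eval x = ∏ j ∈ Finset.range k, (1 - x / ((j:ℝ) + 1)) := by
    intro x
    simp only [P, Polynomial.eval_prod]
    refine Finset.prod_congr rfl fun j _ => ?_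
    simp
    ring
  have hq : ∀ x : ℝ, q.eval x = 1 / T0 * ((∏ j ∈ Finset.range k, (1 - x / ((j:ℝ) + 1))) *
      (Polynomial.Chebyshev.T ℝ m).eval (1 + d - 2 / N * x)) := by
    intro x
    simp only [q, lin, Polynomial.eval_mul, Polynomial.eval_C, hP, Polynomial.eval_comp,
      Polynomial.eval_sub, Polynomial.eval_X]
  have hPd : P.natDegree ≤ k := by
    refine (Polynomial.natDegree_prod_le _ _).trans ?_
    calc _ ≤ ∑ j ∈ Finset.range k, 1 := by
          apply Finset.sum_le_sum
          intro j _
          compute_degree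
      _ = k := by simp
  have hlind : lin.natDegree ≤ 1 := by
    simp only [lin]; compute_degree
  have hqd : q.natDegree ≤ r := by
    refine (Polynomial.natDegree_C_mul_le _ _).trans ?_
    refine Polynomial.natDegree_mul_le.trans ?_
    rw [Polynomial.natDegree_comp, Polynomial.Chebyshev.natDegree_T]
    simp only [Int.natAbs_natCast]
    have : m * lin.natDegree ≤ m * 1 := Nat.mul_le_mul_left _ hlind
    omega
  refine ⟨1 - q, ?_, ?_, ?_⟩
  · refine (Polynomial.natDegree_sub_le _ _).trans ?_
    simpa using hqd
  · rw [Polynomial.eval_sub, hq]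
    simp only [Polynomial.eval_one, zero_div, sub_zero, Finset.prod_const_one, mul_zero, one_mul]
    rw [← hT0]
    field_simp
    simp
  intro i hi1 hiN
  rw [Polynomial.eval_sub, Polynomial.eval_one, sub_sub_cancel_left, abs_neg, hq]
  rcases le_or_gt i k with hik | hik
  · have : ∏ j ∈ Finset.range k, (1 - (i:ℝ) / ((j:ℝ) + 1)) = 0 := by
      apply Finset.prod_eq_zero (i := i - 1) (by rw [Finset.mem_range]; omega)
      have h6 : ((i - 1 : ℕ) : ℝ) + 1 = i := by exact_mod_cast (by omega : i - 1 + 1 = i)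
      have h7 : (i:ℝ) ≠ 0 := by exact_mod_cast (by omega : i ≠ 0)
      rw [h6, div_self h7, sub_self]
    rw [this]
    simp
    positivity
  have hb := kls_prod_bound k N i hi1 hiN hik
  have hiN' : (i:ℝ) ≤ N := by exact_mod_cast hiN
  have hik' : (k:ℝ) + 1 ≤ i := by exact_mod_cast hik
  have hx : |1 + d - 2 / N * i| ≤ 1 := by
    have e1 : 1 + d - 2 / N * i = 1 + 2 * (k + 1 - i) / N := by rw [hd]; ring
    rw [e1, abs_le]
    constructor
    · have : (-2:ℝ) ≤ 2 * (k + 1 - i) / N := by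
        rw [le_div_iff₀ hNR]
        have : (0:ℝ) ≤ k := by positivity
        linarith
      linarith
    · have : 2 * (k + 1 - (i:ℝ)) / N ≤ 0 :=
        div_nonpos_of_nonpos_of_nonneg (by linarith) hNR.le
      linarith
  have hTx : |(Polynomial.Chebyshev.T ℝ m).eval (1 + d - 2 / N * i)| ≤ 1 :=
    Polynomial.Chebyshev.abs_eval_T_real_le_one m hx
  have hNk : (N:ℝ) ^ k = Real.exp (k * L) := by
    rw [Real.exp_nat_mul, hL, Real.exp_log hNR]
  rw [abs_mul, abs_mul, abs_of_pos (by positivity : 0 < 1 / T0)]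
  calc 1 / T0 * (|∏ j ∈ Finset.range k, (1 - (i:ℝ) / ((j:ℝ) + 1))| *
        |(Polynomial.Chebyshev.T ℝ m).eval (1 + d - 2 / N * i)|)
      ≤ 1 / (Real.exp (m * Real.sqrt d) / 2) * (Real.exp (k * L) * 1) := by
        rw [← hNk]; gcongr
    _ = 2 * Real.exp (k * L - m * Real.sqrt d) := by
        rw [Real.exp_sub]; field_simp
    _ ≤ _ := by
        gcongr
        have : -(1/16) * (r:ℝ) ^ 2 / (N * L) = r ^ 2 / (16 * N * L) - r ^ 2 / (8 * N * L) := by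
          field_simp; norm_num
        rw [this]
        linarith
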